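/- For no integer n ≥ 6 divisible by 3 do there exist permutations σ₁, σ₂, σ₃ of {1,…,n} with σ₁σ₂σ₃ = 1, generating a subgroup that acts transitively on {1,…,n}, such that the full cycle type of σ₁ consists of one 2, one 4, and (n−6)/3 copies of 3, and the full cycle types of σ₂ and σ₃ each consist of n/3 copies of 3. (That is, the genus-1 ramification type [2,4,3^*][3^*][3^*] is not realizable in any degree.) -/

import Mathlib

/-- The full cycle type of a permutation of a finite set: the multiset of the lengths of its
cycles, where each fixed point counts as a cycle of length 1. -/
def fullCycleType {α : Type*} [Fintype α] [DecidableEq α] (σ : Equiv.Perm α) : Multiset ℕ :=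
  σ.cycleType + Multiset.replicate (Fintype.card α - σ.cycleType.sum) 1

/-- The subgroup generated by a set of permutations acts transitively. -/
def IsTransitiveSet {α : Type*} (s : Set (Equiv.Perm α)) : Prop :=
  ∀ x y : α, ∃ g ∈ Subgroup.closure s, g x = y

/-- A ramification data, given as a list of multisets of positive integers (partitions of `n`),
is realizable if there are permutations of `{1,…,n}` with product 1, generating a transitive
subgroup, whose full cycle types are the given multisets. -/
def Realizable (n : ℕ) (E : List (Multiset ℕ)) : Prop :=
  ∃ σ : List (Equiv.Perm (Fin n)),
    σ.map fullCycleType = E ∧ σ.prod = 1 ∧ IsTransitiveSet {g | g ∈ σ}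

/-- A finite connected triangulation of an oriented surface with properly two-coloured triangles,
encoded by the permutations `x` and `y` of its edges that rotate the black and the white triangles
(with inverses `X` and `Y`). The cycles of `y ∘ X` are the vertices; one vertex `o` has
degree four, and all the others have degree at most three. -/
structure TwoColoredTriangulation (E : Type*) where
  x : E → E
  X : E → E
  y : E → E
  Y : E → E
  xx : ∀ e, x (x e) = X e
  xX : ∀ e, x (X e) = e
  yy : ∀ e, y (y e) = Y e
  yY : ∀ e, y (Y e) = e
  o : ZMod 4 → E
  o_injective : Function.Injective o
  yX_o : ∀ k, y (X (o k)) = o (k + 1)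
  other : ∀ e, (∀ k, e ≠ o k) →
    (y (X (y (X e))) = e ∧ y (X e) ≠ e) ∨ y (X (y (X (y (X e))))) = e
  connected : ∀ S : Set E, S.Nonempty → (∀ e ∈ S, x e ∈ S) → (∀ e ∈ S, y e ∈ S) → ∀ e, e ∈ S

theorem Set.exists_mem_apply_eq_of_injOn {E : Type*} [Finite E] {f : E → E} {S : Set E}
    (hf : Set.InjOn f S) (h : ∀ e ∈ S, f e ∈ S) : ∀ e ∈ S, ∃ d ∈ S, f d = e := by
  have := Fintype.ofFinite E
  classical
  have := Finset.surjOn_of_injOn_of_card_le (s := S.toFinset) (t := S.toFinset) f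
    (by simpa [Set.MapsTo] using h) (by simpa using hf) le_rfl
  intro e he
  simpa using this (by simpa using he : e ∈ (S.toFinset : Set E))

theorem Set.leftInverse_mem_of_mapsTo {E : Type*} [Finite E] {f g : E → E}
    (hgf : Function.LeftInverse g f) {S : Set E} (h : ∀ e ∈ S, f e ∈ S) : ∀ e ∈ S, g e ∈ S := by
  intro e he
  obtain ⟨d, hd, rfl⟩ := Set.exists_mem_apply_eq_of_injOn hgf.injective.injOn h e he
  rwa [hgf d]

theorem Set.eq_of_subset_of_forall_exists_apply_eq {E : Type*} [Finite E] {f : E → E} {S D : Set E}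
    (hSD : S ⊆ D) (h : ∀ e ∈ D, ∃ d ∈ S, f d = e) : S = D := by
  apply Set.eq_of_subset_of_ncard_le hSD
  calc D.ncard ≤ (f '' S).ncard := Set.ncard_le_ncard fun e he => h e he
    _ ≤ S.ncard := Set.ncard_image_le

theorem exists_pos_add_smul_le_one {E : Type*} [Finite E] {b η : E → ℝ} (hb : ∀ e, b e ≤ 1)
    (hη : ∀ e, b e = 1 → η e ≤ 0) :
    ∃ ε : ℝ, 0 < ε ∧ (∀ e, (b + ε • η) e ≤ 1) ∧ ∀ e, (b + ε • η) e = 1 ↔ b e = 1 ∧ η e = 0 := by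
  have hev : ∀ᶠ ε : ℝ in nhdsWithin 0 (Set.Ioi 0), ∀ e, b e < 1 → b e + ε * η e < 1 := by
    refine Filter.eventually_all.2 fun e => ?_
    by_cases he : b e < 1
    · have hc : Continuous fun ε : ℝ => b e + ε * η e := by fun_prop
      have := hc.tendsto 0
      simp only [zero_mul, add_zero] at this
      exact ((this.mono_left nhdsWithin_le_nhds).eventually_lt_const he).mono fun _ h _ => h
    · exact Filter.Eventually.of_forall fun _ h => absurd h he
  obtain ⟨ε, hε, (h0 : 0 < ε)⟩ := (hev.and self_mem_nhdsWithin).exists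
  refine ⟨ε, h0, fun e => ?_, fun e => ?_⟩ <;>
    simp only [Pi.add_apply, Pi.smul_apply, smul_eq_mul] <;>
    rcases (hb e).lt_or_eq with he | he
  · exact (hε e he).le
  · nlinarith [hη e he]
  · have := hε e he
    constructor
    · intro h; linarith
    · rintro ⟨h, -⟩; linarith
  · simp [he, h0.ne']

namespace TwoColoredTriangulation

variable {E : Type*}

attribute [simp] xx xX yy yY yX_o

section Basic

variable (t : TwoColoredTriangulation E)

@[simp] theorem Xx (e : E) : t.X (t.x e) = e := by rw [← t.xx (t.x e), t.xx e, t.xX]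

@[simp] theorem Yy (e : E) : t.Y (t.y e) = e := by rw [← t.yy (t.y e), t.yy e, t.yY]

@[simp] theorem XX (e : E) : t.X (t.X e) = t.x e := by rw [← t.xx (t.X e), t.xX]

@[simp] theorem YY (e : E) : t.Y (t.Y e) = t.y e := by rw [← t.yy (t.Y e), t.yY]

@[simp] theorem xY_o (k : ZMod 4) : t.x (t.Y (t.o k)) = t.o (k - 1) := by
  have h := t.yX_o (k - 1)
  rw [sub_add_cancel] at h
  rw [← h, t.Yy, t.xX]

theorem Y_o (k : ZMod 4) : t.Y (t.o k) = t.X (t.o (k - 1)) := by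
  rw [← t.xY_o k, t.Xx]

/-- The triangulation with the two colours, and hence the orientation, exchanged. -/
def swap : TwoColoredTriangulation E where
  x := t.y
  X := t.Y
  y := t.x
  Y := t.X
  xx := t.yy
  xX := t.yY
  yy := t.xx
  yY := t.xX
  o k := t.o (-k)
  o_injective := t.o_injective.comp neg_injective
  yX_o k := by rw [t.xY_o]; ring_nf
  other e he := by
    have inv : Function.LeftInverse (fun e => t.x (t.Y e)) (fun e => t.y (t.X e)) := by
      intro e; simp
    rcases t.other e (fun k hk => he (-k) (by simpa using hk)) with ⟨h, h'⟩ | h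
    · refine Or.inl ⟨?_, fun h1 => h' ?_⟩
      · nth_rw 1 [← h]; simp
      · nth_rw 1 [← h1]; simp
    · right; nth_rw 1 [← h]; simp
  connected S h1 h2 h3 := t.connected S h1 h3 h2

/-- The rotation about the initial vertex of an edge, in the negative direction. -/
def Z (e : E) : E := t.x (t.Y e)

theorem head_cases (e : E) : (∃ k, e = t.X (t.o k)) ∨
    t.y (t.X (t.y e)) = t.x (t.Y (t.x e)) ∨
    (t.y (t.X (t.y e)) = t.x e ∧ t.x (t.Y (t.x e)) = t.y e ∧ t.y e ≠ t.x e) := by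
  by_cases h : ∃ k, t.x e = t.o k
  · obtain ⟨k, hk⟩ := h
    exact Or.inl ⟨k, by rw [← hk, t.Xx]⟩
  · push Not at h
    rcases t.other _ h with ⟨h, h'⟩ | h
    · refine Or.inr (Or.inr ⟨by simpa using h, ?_, by simpa using h'⟩)
      nth_rw 1 [← h]; simp
    · exact Or.inr (Or.inl (by simpa using congrArg (fun u => t.x (t.Y u)) h))

theorem tail_cases (e : E) : (∃ k, e = t.o k) ∨
    t.X (t.y (t.X e)) = t.Y (t.x (t.Y e)) ∨
    (t.X (t.y (t.X e)) = t.Y e ∧ t.Y (t.x (t.Y e)) = t.X e) := by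
  by_cases h : ∃ k, e = t.o k
  · exact Or.inl h
  · push Not at h
    rcases t.other _ h with ⟨h, -⟩ | h
    · have h' : t.y (t.X e) = t.x (t.Y e) := by nth_rw 2 [← h]; simp
      exact Or.inr (Or.inr ⟨by rw [h']; simp, by rw [← h']; simp⟩)
    · refine Or.inr (Or.inl ?_)
      nth_rw 2 [← h]; simp

theorem exists_Z_iterate_period (e : E) : t.Z^[12] e = e := by
  by_cases h : ∃ k, e = t.o k
  · obtain ⟨k, rfl⟩ := h
    simp only [Function.iterate_succ, Function.iterate_zero, Function.comp, Z, xY_o, id]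
    congr 1
    revert k; decide
  · push Not at h
    rcases t.other _ h with ⟨h, -⟩ | h
    · have : t.Z (t.Z e) = e := by nth_rw 1 [← h]; simp [Z]
      simp [Function.iterate_succ, this]
    · have : t.Z (t.Z (t.Z e)) = e := by nth_rw 1 [← h]; simp [Z]
      simp [Function.iterate_succ, this]

theorem yX_eq_Z_iterate (e : E) : t.y (t.X e) = t.Z^[11] e := by
  rw [← t.exists_Z_iterate_period (t.y (t.X e)), Function.iterate_succ_apply]
  simp [Z]

theorem swap_Z_iterate (j : ℕ) (e : E) : t.swap.Z^[j] e = t.Z^[11 * j] e := by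
  rw [Function.iterate_mul]
  congr 1
  funext e
  exact t.yX_eq_Z_iterate e

theorem exists_Z_iterate_of_swap {j : ℕ} (e : E) : ∃ i, t.Z^[i] (t.x e) = t.swap.Z^[j] (t.y e) := by
  refine ⟨11 * j + 11, ?_⟩
  have := t.yX_eq_Z_iterate (t.x e)
  rw [t.Xx] at this
  rw [swap_Z_iterate, Function.iterate_add_apply, ← this]

/-- A set of edges each of which ends at the initial vertex of an edge of the set. -/
def Persistent (S : Set E) : Prop := ∀ e ∈ S, ∃ j, t.Z^[j] (t.x e) ∈ S

theorem Persistent.swap {t : TwoColoredTriangulation E} {S : Set E} (h : t.swap.Persistent S) :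
    t.Persistent S := by
  intro e he
  obtain ⟨j, hj⟩ := h e he
  obtain ⟨i, hi⟩ := t.exists_Z_iterate_of_swap (j := j) e
  exact ⟨i, hi ▸ hj⟩

/-- A function on the edges with vanishing sum round every triangle. -/
def IsClosed (b : E → ℝ) : Prop :=
  ∀ e, b e + b (t.x e) + b (t.X e) = 0 ∧ b e + b (t.y e) + b (t.Y e) = 0

/-- A closed function bounded by one that takes the value one on a persistent
nonempty set of edges, this set being minimal under small perturbations. -/
structure IsTight (b : E → ℝ) : Prop where
  closed : t.IsClosed b
  le_one : ∀ e, b e ≤ 1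
  nonempty : ∃ e, b e = 1
  persistent : t.Persistent {e | b e = 1}
  minimal : ∀ η, t.IsClosed η → (∀ e, b e = 1 → η e ≤ 0) →
    ∀ S : Set E, S.Nonempty → t.Persistent S → (∀ e ∈ S, b e = 1 ∧ η e = 0) →
      ∀ e, b e = 1 → η e = 0

theorem IsClosed.swap {t : TwoColoredTriangulation E} {b : E → ℝ} (h : t.IsClosed b) :
    t.swap.IsClosed b := fun e => ⟨(h e).2, (h e).1⟩

theorem IsTight.swap {t : TwoColoredTriangulation E} {b : E → ℝ} (h : t.IsTight b) :
    t.swap.IsTight b where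
  closed := h.closed.swap
  le_one := h.le_one
  nonempty := h.nonempty
  persistent := Persistent.swap (t := t.swap) h.persistent
  minimal η hη h0 S hS hp := h.minimal η hη.swap h0 S hS hp.swap

end Basic

namespace IsTight

variable {t : TwoColoredTriangulation E} {b : E → ℝ}

theorem x_x (h : t.IsTight b) {e : E} (h0 : b e = 1) (h1 : b (t.x e) = 1) :
    b (t.y (t.X e)) = 1 ∧ b (t.Y (t.X e)) = 1 ∧ b (t.X e) ≠ 1 := by
  have h2 := (h.closed e).1
  have h3 := (h.closed (t.X e)).2
  have h4 := h.le_one (t.y (t.X e))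
  have h5 := h.le_one (t.Y (t.X e))
  refine ⟨?_, ?_, fun h6 => ?_⟩ <;> linarith

theorem y_y (h : t.IsTight b) {e : E} (h0 : b e = 1) (h1 : b (t.y e) = 1) :
    b (t.x (t.Y e)) = 1 ∧ b (t.X (t.Y e)) = 1 ∧ b (t.Y e) ≠ 1 :=
  h.swap.x_x h0 h1

end IsTight

section Lines

variable {t : TwoColoredTriangulation E} {b : E → ℝ}

/-- The edges from which the straight path keeping to the left stays in `{e | b e = 1}`. -/
def leftLine (t : TwoColoredTriangulation E) (b : E → ℝ) : Set E :=
  {e | ∀ k, b ((fun e => t.x (t.Y (t.x e)))^[k] e) = 1}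

/-- The edges from which the straight path keeping to the right stays in `{e | b e = 1}`. -/
def rightLine (t : TwoColoredTriangulation E) (b : E → ℝ) : Set E := t.swap.leftLine b

theorem apply_of_mem_leftLine {e : E} (he : e ∈ t.leftLine b) : b e = 1 := he 0

theorem apply_of_mem_rightLine {e : E} (he : e ∈ t.rightLine b) : b e = 1 := he 0

theorem xYx_mem_leftLine {e : E} (he : e ∈ t.leftLine b) :
    t.x (t.Y (t.x e)) ∈ t.leftLine b := fun k => he (k + 1)

theorem yXy_mem_rightLine {e : E} (he : e ∈ t.rightLine b) :
    t.y (t.X (t.y e)) ∈ t.rightLine b := fun k => he (k + 1)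

variable [Finite E]

theorem XyX_mem_leftLine {e : E} (he : e ∈ t.leftLine b) :
    t.X (t.y (t.X e)) ∈ t.leftLine b :=
  Set.leftInverse_mem_of_mapsTo (f := fun e => t.x (t.Y (t.x e)))
    (g := fun e => t.X (t.y (t.X e))) (fun e => by simp) (fun _ => xYx_mem_leftLine) e he

theorem YxY_mem_rightLine {e : E} (he : e ∈ t.rightLine b) :
    t.Y (t.x (t.Y e)) ∈ t.rightLine b :=
  XyX_mem_leftLine (t := t.swap) he

open Classical in
theorem isClosed_indicator_of_XyX_mem {D : Set E} (hD : ∀ e ∈ D, t.X (t.y (t.X e)) ∈ D)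
    (c : ℝ) :
    t.IsClosed fun g => c * ((if t.X g ∈ D then 1 else 0) - if t.X (t.y g) ∈ D then 1 else 0) := by
  have hD' : ∀ e, t.X (t.y (t.X e)) ∈ D ↔ e ∈ D := fun e =>
    ⟨fun h => by
      have := Set.leftInverse_mem_of_mapsTo (f := fun e => t.X (t.y (t.X e)))
        (g := fun e => t.x (t.Y (t.x e))) (fun e => by simp) hD _ h
      simpa using this, hD e⟩
  have hx : ∀ g, t.X (t.y g) ∈ D ↔ t.x g ∈ D := fun g => by
    rw [← hD' (t.x g), t.Xx]
  intro e
  constructor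
  · simp only [hx, Xx, XX, xX, xx]
    ring
  · simp only [yY, yy]
    ring

namespace IsTight

variable (h : t.IsTight b)

include h

theorem x_ne_of_mem_leftLine {e : E} (he : e ∈ t.leftLine b) : b (t.x e) ≠ 1 := by
  intro hxe
  set D : Set E := {e | e ∈ t.leftLine b ∧ b (t.x e) = 1}
  have hD : ∀ e ∈ D, t.X (t.y (t.X e)) ∈ D := by
    rintro e ⟨he, hxe⟩
    refine ⟨XyX_mem_leftLine he, ?_⟩
    have := (h.x_x (apply_of_mem_leftLine he) hxe).1
    simpa using this
  have hD' : ∀ e ∈ D, t.x (t.Y (t.x e)) ∈ D :=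
    Set.leftInverse_mem_of_mapsTo (f := fun e => t.X (t.y (t.X e)))
      (g := fun e => t.x (t.Y (t.x e))) (fun e => by simp) hD
  have hxD : ∀ e ∈ D, b (t.X e) ≠ 1 := fun e he =>
    (h.x_x (apply_of_mem_leftLine he.1) he.2).2.2
  have hyD : ∀ g, b g = 1 → t.X (t.y g) ∉ D := by
    intro g hg hgD
    have h1 := hxD _ (hD' _ hgD)
    simp only [xX, Yy, Xx] at h1
    exact h1 hg
  have key := h.minimal _ (isClosed_indicator_of_XyX_mem (D := D) hD (-1)) (by
    intro g hg
    simp only [hyD g hg, if_false]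
    split_ifs <;> norm_num) D ⟨e, he, hxe⟩ (fun e he => ⟨1, hD' e he⟩) (by
    intro e he
    have h1 := apply_of_mem_leftLine he.1
    have h2 : t.X e ∉ D := fun h2 => hxD e he (apply_of_mem_leftLine h2.1)
    simp [h1, hyD e h1, h2]) (t.x e) hxe
  have heD : e ∈ D := ⟨he, hxe⟩
  simp [hyD _ hxe, heD] at key

theorem Yx_ne_of_mem_leftLine {e : E} (he : e ∈ t.leftLine b) : b (t.Y (t.x e)) ≠ 1 := by
  intro hye
  have hX : ∀ g, b g = 1 → t.X g ∉ t.leftLine b := fun g hg hgL =>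
    h.x_ne_of_mem_leftLine hgL (by simpa using hg)
  have hXy : ∀ g ∈ t.leftLine b, t.X (t.y g) ∉ t.leftLine b := fun g hg hgL => by
    have h1 := xYx_mem_leftLine hgL
    simp only [xX, Yy] at h1
    exact h.x_ne_of_mem_leftLine hg (apply_of_mem_leftLine h1)
  have key := h.minimal _
    (isClosed_indicator_of_XyX_mem (D := t.leftLine b) (fun e he => XyX_mem_leftLine he) 1) (by
    intro g hg
    simp only [hX g hg, if_false]
    split_ifs <;> norm_num) (t.leftLine b) ⟨e, he⟩ (fun e he => ⟨1, xYx_mem_leftLine he⟩) (by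
    intro e he
    have h1 := apply_of_mem_leftLine he
    simp [h1, hX e h1, hXy e he]) _ hye
  simp [hX _ hye, he] at key

theorem y_ne_of_mem_rightLine {e : E} (he : e ∈ t.rightLine b) : b (t.y e) ≠ 1 :=
  h.swap.x_ne_of_mem_leftLine he

theorem Xy_ne_of_mem_rightLine {e : E} (he : e ∈ t.rightLine b) : b (t.X (t.y e)) ≠ 1 :=
  h.swap.Yx_ne_of_mem_leftLine he

theorem YX_mem_rightLine {e : E} (he : e ∈ t.leftLine b) : t.Y (t.X e) ∈ t.rightLine b := by
  classical
  have := Fintype.ofFinite E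
  have hval : ∀ e ∈ t.leftLine b,
      b (t.Y (t.X e)) = 1 + b (t.x e) - b (t.y (t.X e)) := by
    intro e he
    have h1 := (h.closed e).1
    have h2 := (h.closed (t.X e)).2
    have h3 := apply_of_mem_leftLine he
    linarith
  have hsum : ∑ e ∈ (t.leftLine b).toFinset, b (t.y (t.X e)) =
      ∑ e ∈ (t.leftLine b).toFinset, b (t.x e) := by
    refine Finset.sum_bij' (fun e _ => t.X (t.y (t.X e))) (fun e _ => t.x (t.Y (t.x e)))
      ?_ ?_ ?_ ?_ ?_
    · intro e he
      simpa using XyX_mem_leftLine (by simpa using he)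
    · intro e he
      simpa using xYx_mem_leftLine (by simpa using he)
    all_goals simp
  have heq : ∑ e ∈ (t.leftLine b).toFinset, b (t.Y (t.X e)) =
      ∑ e ∈ (t.leftLine b).toFinset, (1 : ℝ) := by
    rw [Finset.sum_congr rfl fun e he => hval e (by simpa using he), Finset.sum_sub_distrib,
      Finset.sum_add_distrib, hsum]
    ring
  have hone : ∀ e ∈ t.leftLine b, b (t.Y (t.X e)) = 1 := by
    simpa using (Finset.sum_eq_sum_iff_of_le fun e _ => h.le_one _).1 heq
  intro k
  have hsemi : Function.Semiconj (fun e => t.Y (t.X e)) (fun e => t.x (t.Y (t.x e)))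
      (fun e => t.y (t.X (t.y e))) := fun e => by simp
  change b ((fun e => t.y (t.X (t.y e)))^[k] ((fun e => t.Y (t.X e)) e)) = 1
  rw [← (hsemi.iterate_right k) e]
  exact hone _ fun j => by
    rw [← Function.iterate_add_apply]
    exact he _

theorem XY_mem_leftLine {e : E} (he : e ∈ t.rightLine b) : t.X (t.Y e) ∈ t.leftLine b :=
  h.swap.YX_mem_rightLine he

theorem exists_o_mem_rightLine (hne : (t.rightLine b).Nonempty) :
    ∃ k, t.X (t.o k) ∈ t.rightLine b := by
  by_contra! hno
  have hp : ∀ f ∈ t.rightLine b, t.y (t.X (t.y f)) = t.x (t.Y (t.x f)) := by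
    intro f hf
    rcases t.head_cases f with ⟨k, rfl⟩ | hf' | ⟨hf1, hf2, hf3⟩
    · exact absurd hf (hno k)
    · exact hf'
    exfalso
    set D : Set E := {e | e ∈ t.rightLine b ∧ b (t.x e) = 1}
    have hreg : ∀ e ∈ D, t.x (t.Y (t.x (t.Y (t.x (t.Y e))))) = e := by
      rintro e ⟨he, hxe⟩
      have hd := YxY_mem_rightLine he
      rcases t.head_cases (t.Y (t.x (t.Y e))) with ⟨k, hk⟩ | h1 | ⟨h1, -, -⟩
      · exact absurd (hk ▸ hd) (hno k)
      · simpa using h1.symm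
      · simp only [yY, Xx] at h1
        have h3 := apply_of_mem_rightLine hd
        have h4 : t.X (t.Y (t.x (t.Y e))) = t.x e := by
          nth_rw 2 [h1]; simp
        exact absurd (h4 ▸ hxe) (h.x_x h3 (h1 ▸ apply_of_mem_rightLine he)).2.2
    have hD : ∀ e ∈ D, t.Y (t.x (t.Y e)) ∈ D := by
      rintro e he
      refine ⟨YxY_mem_rightLine he.1, ?_⟩
      have h1 := (h.x_x (apply_of_mem_rightLine he.1) he.2).1
      have h2 : t.y (t.X e) = t.x (t.Y (t.x (t.Y e))) := by
        nth_rw 1 [← hreg e he]; simp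
      rwa [← h2]
    have hfD : f ∈ D := ⟨hf, hf1 ▸ apply_of_mem_rightLine (yXy_mem_rightLine hf)⟩
    have hfD' := Set.leftInverse_mem_of_mapsTo (f := fun e => t.Y (t.x (t.Y e)))
        (g := fun e => t.y (t.X (t.y e))) (fun e => by simp) hD f hfD
    have h1 := hreg _ hfD'
    simp only [Yy, hf2, hf1] at h1
    exact hf3 h1
  have hRL : ∀ e ∈ t.rightLine b, e ∈ t.leftLine b := by
    intro e he k
    have : ∀ k, (fun e => t.x (t.Y (t.x e)))^[k] e ∈ t.rightLine b := by
      intro k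
      induction k with
      | zero => exact he
      | succ k ih =>
        rw [Function.iterate_succ_apply', ← hp _ ih]
        exact yXy_mem_rightLine ih
    exact apply_of_mem_rightLine (this k)
  have hYX : ∀ e ∈ t.rightLine b, t.Y (t.X e) ∈ t.rightLine b := fun e he =>
    h.YX_mem_rightLine (hRL e he)
  have hxy : ∀ e ∈ t.rightLine b, t.x (t.y e) ∈ t.rightLine b :=
    Set.leftInverse_mem_of_mapsTo (f := fun e => t.Y (t.X e))
      (g := fun e => t.x (t.y e)) (fun e => by simp) hYX
  have hLR : ∀ e ∈ t.leftLine b, e ∈ t.rightLine b := fun e he => by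
    simpa using hxy _ (h.YX_mem_rightLine he)
  have hXY : ∀ e ∈ t.rightLine b, t.X (t.Y e) ∈ t.rightLine b := fun e he =>
    hLR _ (h.XY_mem_leftLine he)
  have hyx : ∀ e ∈ t.rightLine b, t.y (t.x e) ∈ t.rightLine b :=
    Set.leftInverse_mem_of_mapsTo (f := fun e => t.X (t.Y e))
      (g := fun e => t.y (t.x e)) (fun e => by simp) hXY
  have hall := t.connected
    {e | e ∈ t.rightLine b ∨ t.X e ∈ t.rightLine b ∨ t.x e ∈ t.rightLine b}
    (hne.mono fun e he => Or.inl he)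
    (by
      rintro e (he | he | he)
      · exact Or.inr (Or.inl (by simpa using he))
      · exact Or.inr (Or.inr (by simpa using he))
      · exact Or.inl he)
    (by
      rintro e (he | he | he)
      · exact Or.inr (Or.inr (hxy e he))
      · exact Or.inl (by simpa using hyx _ he)
      · refine Or.inr (Or.inl ?_)
        have h1 := hLR _ (XyX_mem_leftLine (hRL _ he))
        simpa using h1) (t.o 0)
  rcases hall with h0 | h0 | h0
  · have h1 := hLR _ (XyX_mem_leftLine (hRL _ h0))
    rw [yX_o] at h1
    exact hno _ h1
  · exact hno _ h0
  · have h1 := hYX _ h0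
    rw [Xx, Y_o] at h1
    exact hno _ h1

theorem exists_o_mem_leftLine (hne : (t.leftLine b).Nonempty) :
    ∃ k, t.Y (t.o k) ∈ t.leftLine b := by
  obtain ⟨k, hk⟩ := h.swap.exists_o_mem_rightLine hne
  exact ⟨-k, hk⟩

theorem rightLine_eq_empty : t.rightLine b = ∅ := by
  by_contra! hR
  have hL : (t.leftLine b).Nonempty := hR.elim fun e he => ⟨_, h.XY_mem_leftLine he⟩
  have hR1 : ∀ k, t.X (t.o k) ∈ t.rightLine b →
      t.o (k + 2) ∈ t.rightLine b ∧ b (t.o (k + 1)) ≠ 1 ∧ b (t.X (t.o (k + 1))) ≠ 1 := by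
    intro k hk
    have h1 := yXy_mem_rightLine hk
    have h2 := h.y_ne_of_mem_rightLine hk
    have h3 := h.Xy_ne_of_mem_rightLine hk
    simp only [yX_o] at h1 h2 h3
    refine ⟨?_, h2, h3⟩
    convert h1 using 2
    ring
  have hL1 : ∀ k, t.X (t.o k) ∈ t.leftLine b →
      t.o (k - 1) ∈ t.leftLine b ∧ b (t.o k) ≠ 1 ∧ b (t.X (t.o (k - 1))) ≠ 1 := by
    intro k hk
    have h1 := xYx_mem_leftLine hk
    have h2 := h.x_ne_of_mem_leftLine hk
    have h3 := h.Yx_ne_of_mem_leftLine hk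
    rw [xX] at h1 h2 h3
    rw [xY_o] at h1
    rw [Y_o] at h3
    exact ⟨h1, h2, h3⟩
  set I : Set E := {e | e ∈ t.leftLine b ∧ e ∈ t.rightLine b}
  have hI : ∃ e ∈ I, (∃ k, e = t.X (t.o k)) ∨ ∃ k, t.Y (t.x (t.Y e)) = t.X (t.o k) := by
    obtain ⟨k, hk⟩ := h.exists_o_mem_rightLine hR
    obtain ⟨i, hi⟩ := h.exists_o_mem_leftLine hL
    rw [Y_o] at hi
    obtain ⟨hk1, hk2, hk3⟩ := hR1 k hk
    obtain ⟨hi1, hi2, hi3⟩ := hL1 _ hi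
    have hk0 := apply_of_mem_rightLine hk
    have hi0 := apply_of_mem_leftLine hi
    have hk1' := apply_of_mem_rightLine hk1
    have hi1' := apply_of_mem_leftLine hi1
    have hc : i - 1 = k ∨ i - 1 = k + 1 ∨ i - 1 - 1 = k + 1 ∨ i - 1 - 1 = k + 2 :=
      (by decide : ∀ i k : ZMod 4, i - 1 = k ∨ i - 1 = k + 1 ∨ i - 1 - 1 = k + 1 ∨
        i - 1 - 1 = k + 2) i k
    rcases hc with hc | hc | hc | hc
    · exact ⟨_, ⟨hc ▸ hi, hk⟩, Or.inl ⟨k, rfl⟩⟩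
    · exact absurd (hc ▸ hi0) hk3
    · exact absurd (hc ▸ hi1') hk2
    · refine ⟨_, ⟨hc ▸ hi1, hk1⟩, Or.inr ⟨k, ?_⟩⟩
      rw [xY_o, Y_o]
      ring_nf
  have hI2 : ∃ k, t.X (t.o k) ∈ I := by
    by_contra! hno
    have hreg : ∀ e ∈ I, t.y (t.X (t.y e)) ∈ I := by
      rintro e he
      rcases t.head_cases e with ⟨k, rfl⟩ | h1 | ⟨h1, h2, -⟩
      · exact absurd he (hno k)
      · exact ⟨h1 ▸ xYx_mem_leftLine he.1, yXy_mem_rightLine he.2⟩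
      · exact absurd (h2 ▸ apply_of_mem_leftLine (xYx_mem_leftLine he.1))
          (h.y_ne_of_mem_rightLine he.2)
    obtain ⟨e, he, ⟨k, rfl⟩ | ⟨k, hk⟩⟩ := hI
    · exact hno k he
    · refine hno k (hk ▸ ?_)
      exact Set.leftInverse_mem_of_mapsTo (f := fun e => t.y (t.X (t.y e)))
        (g := fun e => t.Y (t.x (t.Y e))) (fun e => by simp) hreg e he
  obtain ⟨k, hk⟩ := hI2
  have hI3 : ∃ m, t.o m ∈ I := by
    by_contra! hno
    have hreg : ∀ e ∈ I, t.Y (t.x (t.Y e)) ∈ I := by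
      rintro e he
      rcases t.tail_cases e with ⟨k, rfl⟩ | h1 | ⟨h1, h2⟩
      · exact absurd he (hno k)
      · exact ⟨h1 ▸ XyX_mem_leftLine he.1, YxY_mem_rightLine he.2⟩
      · have h3 := h.Yx_ne_of_mem_leftLine (XyX_mem_leftLine he.1)
        rw [h1] at h3
        exact absurd (apply_of_mem_rightLine (YxY_mem_rightLine he.2)) h3
    have h1 := Set.leftInverse_mem_of_mapsTo (f := fun e => t.Y (t.x (t.Y e)))
        (g := fun e => t.y (t.X (t.y e))) (fun e => by simp) hreg _ hk
    simp only [yX_o] at h1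
    exact hno _ h1
  obtain ⟨m, hm⟩ := hI3
  have h1 := apply_of_mem_leftLine (XyX_mem_leftLine hm.1)
  have h2 := apply_of_mem_rightLine (YxY_mem_rightLine hm.2)
  rw [yX_o] at h1
  rw [xY_o, Y_o] at h2
  have h3 := (hR1 k hk.2).2.2
  have h4 := (hL1 k hk.1).2.2
  have hc : m + 1 = k + 1 ∨ m - 1 - 1 = k + 1 ∨ m + 1 = k - 1 ∨ m - 1 - 1 = k - 1 :=
    (by decide : ∀ m k : ZMod 4, m + 1 = k + 1 ∨ m - 1 - 1 = k + 1 ∨ m + 1 = k - 1 ∨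
      m - 1 - 1 = k - 1) m k
  rcases hc with hc | hc | hc | hc
  · exact h3 (hc ▸ h1)
  · exact h3 (hc ▸ h2)
  · exact h4 (hc ▸ h1)
  · exact h4 (hc ▸ h2)

theorem leftLine_eq_empty : t.leftLine b = ∅ := h.swap.rightLine_eq_empty

end IsTight
end Lines

section Push

variable (t : TwoColoredTriangulation E)

open Classical in
/-- The number of outgoing edges swept when each edge `e` of `O`, followed by the
`l e`-th outgoing edge at its terminal vertex, is pushed to the left. -/
noncomputable def pushWeight (O : Finset E) (l : E → ℕ) (g : E) : ℝ :=
  ∑ e ∈ O, ∑ j ∈ Finset.range (l e), if t.Z^[j] (t.x e) = g then 1 else 0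

variable {t}

open Classical in
theorem pushWeight_y {O : Finset E} {l : E → ℕ}
    (hl : Set.BijOn (fun e => t.Z^[l e] (t.x e)) O O) (g : E) :
    t.pushWeight O l (t.y g) = t.pushWeight O l (t.x g) - (if g ∈ O then 1 else 0) +
      if t.x g ∈ O then 1 else 0 := by
  have hZ : ∀ a, a = t.y g ↔ t.Z a = t.x g := fun a => by
    constructor
    · rintro rfl; simp [Z]
    · intro h
      rw [← t.Xx g, ← h]
      simp [Z]
  have himage : O.image (fun e => t.Z^[l e] (t.x e)) = O := by
    rw [← Finset.coe_inj, Finset.coe_image]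
    exact hl.image_eq
  have h1 : ∑ e ∈ O, (if t.x e = t.x g then (1 : ℝ) else 0) = if g ∈ O then 1 else 0 := by
    have hx : Function.Injective t.x := Function.LeftInverse.injective t.Xx
    simp [hx.eq_iff]
  have h2 : ∑ e ∈ O, (if t.Z^[l e] (t.x e) = t.x g then (1 : ℝ) else 0) =
      if t.x g ∈ O then 1 else 0 := by
    rw [← Finset.sum_image (f := fun a => if a = t.x g then (1 : ℝ) else 0)
      (g := fun e => t.Z^[l e] (t.x e)) hl.injOn, himage]
    simp
  rw [← h1, ← h2, pushWeight, pushWeight, ← Finset.sum_sub_distrib, ← Finset.sum_add_distrib]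
  refine Finset.sum_congr rfl fun e _ => ?_
  have h3 : ∀ φ : E → ℝ, ∑ j ∈ Finset.range (l e), φ (t.Z (t.Z^[j] (t.x e))) =
      ∑ j ∈ Finset.range (l e), φ (t.Z^[j] (t.x e)) - φ (t.x e) + φ (t.Z^[l e] (t.x e)) := by
    intro φ
    have := Finset.sum_range_succ (fun j => φ (t.Z^[j] (t.x e))) (l e)
    rw [Finset.sum_range_succ'] at this
    simp only [Function.iterate_succ_apply', Function.iterate_zero, id] at this
    linarith
  have h4 : ∑ j ∈ Finset.range (l e), (if t.Z^[j] (t.x e) = t.y g then (1 : ℝ) else 0) =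
      ∑ j ∈ Finset.range (l e), if t.Z (t.Z^[j] (t.x e)) = t.x g then 1 else 0 :=
    Finset.sum_congr rfl fun j _ => if_congr (hZ _) rfl rfl
  exact h4.trans (h3 fun a => if a = t.x g then 1 else 0)

theorem isClosed_pushWeight {O : Finset E} {l : E → ℕ}
    (hl : Set.BijOn (fun e => t.Z^[l e] (t.x e)) O O) :
    t.IsClosed fun g => t.pushWeight O l g - t.pushWeight O l (t.y g) := by
  intro e
  constructor
  · beta_reduce
    rw [pushWeight_y hl, pushWeight_y hl, pushWeight_y hl, t.xX, t.xx]
    ring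
  · simp only [yY, yy]
    ring

variable {b : E → ℝ}

theorem IsTight.Y_iterate_Z_ne (h : t.IsTight b) {O : Finset E} {l : E → ℕ}
    (hl : Set.BijOn (fun e => t.Z^[l e] (t.x e)) O O) (hO : ∀ e ∈ O, b e = 1)
    (hlt : ∀ e ∈ O, ∀ j < l e, b (t.Z^[j] (t.x e)) ≠ 1) {e : E} (he : e ∈ O) {j : ℕ}
    (hj : j < l e) : b (t.Y (t.Z^[j] (t.x e))) ≠ 1 := by
  intro hb
  have hzero : ∀ g, b g = 1 → t.pushWeight O l g = 0 := by
    intro g hg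
    refine Finset.sum_eq_zero fun e he => Finset.sum_eq_zero fun j hj => if_neg ?_
    rintro rfl
    exact hlt e he j (Finset.mem_range.1 hj) hg
  have hnonneg : ∀ g, 0 ≤ t.pushWeight O l g := fun g =>
    Finset.sum_nonneg fun e _ => Finset.sum_nonneg fun j _ => by split_ifs <;> norm_num
  have hmem : ∀ e ∈ O, t.Z^[l e] (t.x e) ∈ O := hl.mapsTo
  have hle : ∀ e ∈ O, ∀ j, b (t.Z^[j] (t.x e)) = 1 → l e ≤ j := fun e he j hj => by
    by_contra! hlt'
    exact hlt e he j hlt' hj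
  have hOzero : ∀ e ∈ O, t.pushWeight O l (t.y e) = 0 := by
    intro e he
    refine Finset.sum_eq_zero fun d hd => Finset.sum_eq_zero fun j hj => if_neg fun hde => ?_
    have hjl := Finset.mem_range.1 hj
    have hxe : ∀ i, t.Z^[i] (t.x e) = t.Z^[i + (j + 1)] (t.x d) := by
      intro i
      rw [Function.iterate_add_apply, Function.iterate_succ_apply', hde]
      simp [Z]
    have h1 := hO _ (hmem d hd)
    rw [show l d = (l d - (j + 1)) + (j + 1) by omega, ← hxe] at h1
    have h2 := hle e he _ h1
    have h3 := hO _ (hmem e he)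
    rw [hxe] at h3
    have h4 := hle d hd _ h3
    have h5 : e = d := hl.injOn he hd (by
      simp only [hxe]
      rw [show l e + (j + 1) = l d by omega])
    subst h5
    omega
  have key := h.minimal _ (isClosed_pushWeight hl)
    (fun g hg => by rw [hzero g hg]; linarith [hnonneg (t.y g)]) O ⟨e, he⟩
    (fun e he => ⟨l e, hmem e he⟩)
    (fun e he => ⟨hO e he, by rw [hzero e (hO e he), hOzero e he, sub_zero]⟩) _ hb
  rw [hzero _ hb, yY, zero_sub, neg_eq_zero] at key
  have h1 := (Finset.sum_eq_zero_iff_of_nonneg (fun e _ => Finset.sum_nonneg fun j _ => by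
    split_ifs <;> norm_num)).1 key e he
  have h2 := (Finset.sum_eq_zero_iff_of_nonneg (fun j _ => by
    split_ifs <;> norm_num)).1 h1 j (Finset.mem_range.2 hj)
  simp at h2

end Push

section Leftmost

variable {t : TwoColoredTriangulation E} {b : E → ℝ}

/-- The number of steps from `x e`, in the negative direction about its initial vertex, to the
first edge in `{e | b e = 1}`. -/
noncomputable def turn (t : TwoColoredTriangulation E) (b : E → ℝ) (e : E) : ℕ :=
  sInf {j | b (t.Z^[j] (t.x e)) = 1}

/-- The leftmost continuation of `e` in `{e | b e = 1}`. -/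
noncomputable def next (t : TwoColoredTriangulation E) (b : E → ℝ) (e : E) : E :=
  t.Z^[t.turn b e] (t.x e)

/-- The edges lying on a cycle of leftmost continuations. -/
def cyc (t : TwoColoredTriangulation E) (b : E → ℝ) : Set E :=
  {e | b e = 1 ∧ e ∈ Function.periodicPts (t.next b)}

theorem ne_of_lt_turn {e : E} {j : ℕ} (hj : j < t.turn b e) : b (t.Z^[j] (t.x e)) ≠ 1 :=
  Nat.notMem_of_lt_sInf hj

namespace IsTight

variable (h : t.IsTight b)

include h

theorem next_eq {e : E} (he : b e = 1) : b (t.next b e) = 1 :=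
  Nat.sInf_mem (s := {j | b (t.Z^[j] (t.x e)) = 1}) (h.persistent e he)

theorem next_mem {e : E} (he : e ∈ t.cyc b) : t.next b e ∈ t.cyc b :=
  ⟨h.next_eq he.1, (Function.bijOn_periodicPts _).mapsTo he.2⟩

omit h in
theorem injOn_next : Set.InjOn (t.next b) (t.cyc b) :=
  (Function.bijOn_periodicPts _).injOn.mono fun _ he => he.2

variable [Finite E]

theorem cyc_nonempty : (t.cyc b).Nonempty := by
  obtain ⟨e, he⟩ := h.nonempty
  have hT : ∀ n, b ((t.next b)^[n] e) = 1 := fun n => by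
    induction n with
    | zero => exact he
    | succ n ih => rw [Function.iterate_succ_apply']; exact h.next_eq ih
  obtain ⟨m, n, hmn, heq⟩ := Finite.exists_ne_map_eq_of_infinite fun n => (t.next b)^[n] e
  wlog hlt : m < n generalizing m n
  · exact this n m hmn.symm heq.symm (by omega)
  refine ⟨_, hT m, Function.mk_mem_periodicPts (n := n - m) (by omega) ?_⟩
  rw [Function.IsPeriodicPt, Function.IsFixedPt, ← Function.iterate_add_apply,
    Nat.sub_add_cancel hlt.le]
  exact heq.symm

theorem exists_next_eq {e : E} (he : e ∈ t.cyc b) : ∃ d ∈ t.cyc b, t.next b d = e :=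
  Set.exists_mem_apply_eq_of_injOn injOn_next (fun _ => h.next_mem) e he

theorem turn_pos {e : E} (he : e ∈ t.cyc b) : 0 < t.turn b e := by
  by_contra! h0
  have hxe := h.next_eq he.1
  rw [next, Nat.le_zero.1 h0, Function.iterate_zero_apply] at hxe
  have hz := (h.x_x he.1 hxe).1
  obtain ⟨d, hd, rfl⟩ := h.exists_next_eq he
  have hsucc : t.turn b d ≠ 0 → False := fun hd0 => by
    obtain ⟨j, hj⟩ := Nat.exists_eq_succ_of_ne_zero hd0
    rw [next, hj, Function.iterate_succ_apply'] at hz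
    refine ne_of_lt_turn (t := t) (b := b) (e := d) (j := j) (by omega) ?_
    simpa [Z] using hz
  by_cases hd0 : t.turn b d = 0
  · rw [next, hd0, Function.iterate_zero_apply] at hxe he
    exact (h.x_x hd.1 he.1).2.2 (by simpa using hxe)
  · exact hsucc hd0

theorem Y_iterate_Z_turn_ne {e : E} (he : e ∈ t.cyc b) {j : ℕ} (hj : j < t.turn b e) :
    b (t.Y (t.Z^[j] (t.x e))) ≠ 1 := by
  classical
  have := Fintype.ofFinite E
  refine h.Y_iterate_Z_ne (O := (t.cyc b).toFinset) (l := t.turn b) ?_ ?_ ?_ (by simpa using he) hj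
  · rw [Set.coe_toFinset]
    exact ⟨fun _ => h.next_mem, injOn_next, fun _ => h.exists_next_eq⟩
  · exact fun e he => (Set.mem_toFinset.1 he).1
  · exact fun e _ j => ne_of_lt_turn

/-- Away from `o`, the leftmost continuation is opposite on both sides, or turns right. -/
theorem next_cases {e : E} (he : e ∈ t.cyc b) : (∃ k, e = t.X (t.o k)) ∨
    (t.next b e = t.x (t.Y (t.x e)) ∧ t.next b e = t.y (t.X (t.y e))) ∨ t.next b e = t.y e := by
  have h0 := h.turn_pos he
  have h1 := h.next_eq he.1
  have hZx : t.Z (t.x e) = t.x (t.Y (t.x e)) := rfl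
  rcases t.head_cases e with hk | hr | ⟨hp1, hp2, -⟩
  · exact Or.inl hk
  · right
    have hZ3 : t.Z (t.Z (t.Z (t.x e))) = t.x e := by
      rw [hZx, ← hr]; simp [Z]
    have hlt : t.turn b e < 3 := by
      by_contra! h3
      obtain ⟨j, hj⟩ := Nat.exists_eq_add_of_le' h3
      rw [next, hj, Function.iterate_add_apply] at h1
      simp only [Function.iterate_succ, Function.iterate_zero, Function.comp, id, hZ3] at h1
      exact ne_of_lt_turn (by omega) h1
    interval_cases hl : t.turn b e
    · left
      rw [next, hl, Function.iterate_one, hZx]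
      exact ⟨rfl, hr.symm⟩
    · right
      rw [next, hl]
      simp only [Function.iterate_succ, Function.iterate_zero, Function.comp, id, hZx]
      rw [← hr]; simp [Z]
  · right
    right
    have hZ2 : t.Z (t.Z (t.x e)) = t.x e := by
      rw [hZx, hp2]; simp [Z]
    have hlt : t.turn b e < 2 := by
      by_contra! h3
      obtain ⟨j, hj⟩ := Nat.exists_eq_add_of_le' h3
      rw [next, hj, Function.iterate_add_apply] at h1
      simp only [Function.iterate_succ, Function.iterate_zero, Function.comp, id, hZ2] at h1
      exact ne_of_lt_turn (by omega) h1
    rw [next, show t.turn b e = 1 by omega, Function.iterate_one, hZx, hp2]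

omit h in
omit [Finite E] in
theorem iterate_Z_X_o (j : ℕ) (k : ZMod 4) : t.Z^[j] (t.x (t.X (t.o k))) = t.o (k - j) := by
  induction j with
  | zero => simp
  | succ j ih =>
    rw [Function.iterate_succ_apply', ih, Z, xY_o]
    push_cast
    ring_nf

theorem next_X_o {k : ZMod 4} (hk : t.X (t.o k) ∈ t.cyc b) :
    b (t.X (t.o k)) = 1 ∧ b (t.o k) ≠ 1 ∧ b (t.X (t.o (k - 1))) ≠ 1 ∧
    ((t.next b (t.X (t.o k)) = t.o (k - 1) ∧ b (t.o (k - 1)) = 1) ∨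
      (b (t.o (k - 1)) ≠ 1 ∧ b (t.X (t.o (k - 2))) ≠ 1 ∧ (b (t.o (k - 2)) = 1 ∨
        (b (t.o (k - 2)) ≠ 1 ∧ b (t.X (t.o (k - 3))) ≠ 1 ∧ b (t.o (k - 3)) = 1)))) := by
  have hlt : ∀ j < t.turn b (t.X (t.o k)), b (t.o (k - j)) ≠ 1 ∧ b (t.X (t.o (k - j - 1))) ≠ 1 := by
    intro j hj
    have h1 := ne_of_lt_turn hj
    have h2 := h.Y_iterate_Z_turn_ne hk hj
    rw [iterate_Z_X_o] at h1 h2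
    rw [Y_o] at h2
    exact ⟨h1, h2⟩
  have hnext : t.next b (t.X (t.o k)) = t.o (k - t.turn b (t.X (t.o k))) := iterate_Z_X_o _ _
  have h1 := h.next_eq hk.1
  have h0 := h.turn_pos hk
  rw [hnext] at h1 ⊢
  set l := t.turn b (t.X (t.o k))
  have h4 : l < 4 := by
    by_contra! h4
    refine (hlt (l - 4) (by omega)).1 ?_
    rwa [Nat.cast_sub h4, (by decide : ((4 : ℕ) : ZMod 4) = 0), sub_zero]
  have ha := hlt 0 h0
  refine ⟨hk.1, by simpa using ha.1, by simpa using ha.2, ?_⟩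
  clear_value l
  interval_cases l
  · left
    push_cast at h1 ⊢
    exact ⟨rfl, h1⟩
  · have hb := hlt 1 (by omega)
    right
    push_cast at h1 hb
    rw [sub_sub, one_add_one_eq_two] at hb
    exact ⟨hb.1, hb.2, Or.inl h1⟩
  · have hb := hlt 1 (by omega)
    have hc := hlt 2 (by omega)
    right
    push_cast at h1 hb hc
    rw [sub_sub, one_add_one_eq_two] at hb
    rw [sub_sub, two_add_one_eq_three] at hc
    exact ⟨hb.1, hb.2, Or.inr ⟨hc.1, hc.2, h1⟩⟩

end IsTight
end Leftmost

section LocalPattern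

variable {t : TwoColoredTriangulation E} {b : E → ℝ}

/-- The two ways in which the edges of a set, outgoing ones being recorded by `a` and incoming
ones by `c`, can be placed round the vertex of degree four. -/
def LocalPattern (a c : ZMod 4 → Prop) : Prop :=
  ∃ k, (c k ∧ ¬a k ∧ ¬c (k - 1) ∧ ¬a (k - 1) ∧ ¬c (k - 2) ∧
      (a (k - 2) ∨ (¬a (k - 2) ∧ ¬c (k - 3) ∧ a (k - 3)))) ∨
    (c k ∧ c (k + 1) ∧ ¬c (k - 1) ∧ ¬c (k - 2) ∧ ¬a k ∧ ¬a (k + 1) ∧ a (k - 1) ∧ a (k - 2))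

theorem LocalPattern.not_swap {a c : ZMod 4 → Prop} (h : LocalPattern a c)
    (h' : LocalPattern (fun j => a (-j)) fun j => c (-j - 1)) : False := by
  obtain ⟨k, hk⟩ := h
  obtain ⟨m, hm⟩ := h'
  have hcases : ∀ u : ZMod 4, u = 0 ∨ u = 1 ∨ u = 2 ∨ u = 3 := by decide
  rcases hcases k with rfl | rfl | rfl | rfl <;> rcases hcases m with rfl | rfl | rfl | rfl <;>
    reduce_mod_char at hk hm <;> tauto

namespace IsTight

variable [Finite E] (h : t.IsTight b)

include h

theorem localPattern : LocalPattern (fun k => b (t.o k) = 1) fun k => b (t.X (t.o k)) = 1 := by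
  by_cases hI : ∃ k, t.X (t.o k) ∈ t.cyc b ∧ t.next b (t.X (t.o k)) ≠ t.o (k - 1)
  · obtain ⟨k, hk, hne⟩ := hI
    obtain ⟨h1, h2, h3, ⟨h4, -⟩ | ⟨h4, h5, h6⟩⟩ := h.next_X_o hk
    · exact absurd h4 hne
    · exact ⟨k, Or.inl ⟨h1, h2, h3, h4, h5, h6⟩⟩
  push Not at hI
  obtain ⟨e₀, he₀, hy₀⟩ : ∃ e ∈ t.cyc b, t.next b e = t.y e := by
    by_contra! hno
    have hL : ∀ e ∈ t.cyc b, t.x (t.Y (t.x e)) ∈ t.cyc b := by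
      intro e he
      have h1 := h.next_mem he
      rcases h.next_cases he with ⟨k, rfl⟩ | ⟨h2, -⟩ | h2
      · rw [hI k he] at h1
        rwa [xX, xY_o]
      · rwa [← h2]
      · exact absurd h2 (hno e he)
    obtain ⟨e, he⟩ := h.cyc_nonempty
    have : ∀ k, (fun e => t.x (t.Y (t.x e)))^[k] e ∈ t.cyc b := fun k => by
      induction k with
      | zero => exact he
      | succ k ih => rw [Function.iterate_succ_apply']; exact hL _ ih
    exact Set.notMem_empty e (h.leftLine_eq_empty ▸ fun k => (this k).1)
  have hy₁ : b (t.y e₀) = 1 := hy₀ ▸ h.next_eq he₀.1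
  obtain ⟨m, hm, hym⟩ : ∃ m, t.o m ∈ t.cyc b ∧ b (t.y (t.o m)) = 1 := by
    by_contra! hno
    have hD := Set.eq_of_subset_of_forall_exists_apply_eq (f := t.next b)
      (S := {e | (e ∈ t.cyc b ∧ b (t.y e) = 1) ∧ t.next b e ≠ t.y e})
      (D := {e | e ∈ t.cyc b ∧ b (t.y e) = 1}) (fun e he => he.1) (by
      rintro e ⟨he, hye⟩
      obtain ⟨d, hd, rfl⟩ := h.exists_next_eq he
      rcases h.next_cases hd with ⟨k, rfl⟩ | ⟨h1, h2⟩ | h2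
      · rw [hI k hd] at he hye
        exact absurd hye (hno _ he)
      · have h3 := (h.y_y he.1 hye).1
        rw [h2, Yy, xX] at h3
        refine ⟨d, ⟨⟨hd, h3⟩, fun h4 => ?_⟩, rfl⟩
        rw [h4] at he hye
        exact (h.y_y hd.1 he.1).2.2 (by simpa using hye)
      · rw [h2] at he hye
        exact absurd (by simpa using hye) (h.y_y hd.1 he.1).2.2)
    have h1 : e₀ ∈ {e | e ∈ t.cyc b ∧ b (t.y e) = 1} := ⟨he₀, hy₁⟩
    rw [← hD] at h1
    exact h1.2 hy₀
  obtain ⟨k, hk, hYk⟩ : ∃ k, t.X (t.o k) ∈ t.cyc b ∧ b (t.Y (t.X (t.o k))) = 1 := by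
    by_contra! hno
    have hC : ∀ g ∈ {g | g ∈ t.cyc b ∧ b (t.Y g) = 1},
        t.next b g ∈ {g | g ∈ t.cyc b ∧ b (t.Y g) = 1} := by
      rintro g ⟨hg, hYg⟩
      have h4 := h.y_y hYg (by simpa using hg.1)
      rw [YY] at h4
      refine ⟨h.next_mem hg, ?_⟩
      rcases h.next_cases hg with ⟨k, rfl⟩ | ⟨h1, h2⟩ | h2
      · exact absurd hYg (hno k hg)
      · rw [h2, Yy]
        exact h4.2.1
      · exact absurd (h2 ▸ h.next_eq hg.1) h4.2.2
    obtain ⟨d, hd, hd'⟩ := Set.exists_mem_apply_eq_of_injOn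
      (injOn_next.mono fun _ hg => hg.1) hC (t.next b e₀)
      ⟨h.next_mem he₀, by rw [hy₀, Yy]; exact he₀.1⟩
    rw [injOn_next hd.1 he₀ hd'] at hd
    have h1 := (h.y_y hd.2 (by rw [yY]; exact he₀.1)).2.2
    rw [YY] at h1
    exact h1 hy₁
  obtain ⟨h1, h2, h3⟩ := h.y_y hm.1 hym
  rw [xY_o] at h1
  rw [Y_o] at h3
  obtain ⟨d, hd, hdm⟩ := h.exists_next_eq hm
  obtain ⟨i, rfl⟩ : ∃ i, d = t.X (t.o i) := by
    rcases h.next_cases hd with hi | ⟨h4, -⟩ | h4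
    · exact hi
    · refine ⟨m + 1, ?_⟩
      rw [← yX_o, ← hdm, h4]
      simp
    · refine ⟨m - 1, ?_⟩
      rw [← Y_o, ← hdm, h4, Yy]
  obtain rfl : i = m + 1 := by
    rw [hI i hd] at hdm
    rw [← t.o_injective hdm]
    ring
  obtain ⟨h4, h5, h6, -⟩ := h.next_X_o hd
  obtain ⟨h7, h8, h9, -⟩ := h.next_X_o hk
  obtain ⟨h10, h11, h12⟩ := h.y_y hYk (by simpa using h7)
  simp only [YY, yX_o] at h11 h12
  have hkm : k = m ∨ k = m - 1 ∨ k = m - 2 ∨ k = m + 1 :=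
    (by decide : ∀ k m : ZMod 4, k = m ∨ k = m - 1 ∨ k = m - 2 ∨ k = m + 1) k m
  rcases hkm with rfl | rfl | rfl | rfl
  · exact absurd hm.1 h8
  · exact absurd (by simpa using hm.1) h12
  · rw [show m - 2 + 1 = m - 1 by ring] at h12
    exact absurd h1 h12
  · have e1 : m + 1 - 2 = m - 1 := by ring
    rw [add_sub_cancel_right] at h6 h9
    refine ⟨m + 1, Or.inr ?_⟩
    rw [add_sub_cancel_right, e1]
    exact ⟨h4, h11, h9, h3, h8, h12, hm.1, h1⟩

theorem false : False := by
  have hc : (fun k => b (t.X (t.o (-k - 1))) = 1) = fun k => b (t.Y (t.o (-k))) = 1 := by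
    simp only [Y_o]
  exact h.localPattern.not_swap (hc ▸ h.swap.localPattern)

end IsTight
end LocalPattern

section Existence

variable (t : TwoColoredTriangulation E) {b : E → ℝ}

theorem IsClosed.add_smul {t : TwoColoredTriangulation E} {b η : E → ℝ} (hb : t.IsClosed b)
    (hη : t.IsClosed η) (ε : ℝ) : t.IsClosed (b + ε • η) := by
  intro e
  simp only [Pi.add_apply, Pi.smul_apply, smul_eq_mul]
  constructor
  · linear_combination (hb e).1 + ε * (hη e).1
  · linear_combination (hb e).2 + ε * (hη e).2

variable {C : Type*} {p : E → C}

/-- The coboundary of a function on the vertices, `p` being the initial vertex of an edge. -/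
def coboundary (t : TwoColoredTriangulation E) (p : E → C) : (C → ℝ) →ₗ[ℝ] E → ℝ where
  toFun f e := f (p (t.x e)) - f (p e)
  map_add' f g := by ext e; simp only [Pi.add_apply]; ring
  map_smul' r f := by ext e; simp only [Pi.smul_apply, smul_eq_mul, RingHom.id_apply]; ring

variable {t}

theorem isClosed_coboundary (hp : ∀ e, p (t.Z e) = p e) (f : C → ℝ) :
    t.IsClosed (t.coboundary p f) := by
  have hxy : ∀ e, p (t.x e) = p (t.y e) := fun e => by
    rw [← hp (t.y e), Z, t.Yy]
  intro e
  simp only [coboundary, LinearMap.coe_mk, AddHom.coe_mk]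
  constructor
  · simp only [xx, xX]; ring
  · simp only [hxy, yy, yY]; ring

open Classical in
theorem exists_coboundary_of_not_persistent (hp : ∀ e e', p e = p e' ↔ ∃ j, t.Z^[j] e = e')
    {T : Set E} (hT : ¬ t.Persistent T) :
    ∃ f : C → ℝ, (∀ e ∈ T, t.coboundary p f e ≤ 0) ∧ (∃ e ∈ T, t.coboundary p f e ≠ 0) ∧
      ∀ S ⊆ T, t.Persistent S → ∀ e ∈ S, t.coboundary p f e = 0 := by
  simp only [Persistent, not_forall, not_exists] at hT
  obtain ⟨e₀, he₀, hno⟩ := hT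
  have hv : ∀ e ∈ T, p e ≠ p (t.x e₀) := fun e he heq => by
    obtain ⟨j, hj⟩ := (hp _ _).1 heq.symm
    exact hno j (hj ▸ he)
  refine ⟨fun v => if v = p (t.x e₀) then -1 else 0, ?_, ⟨e₀, he₀, ?_⟩, ?_⟩
  · intro e he
    simp only [coboundary, LinearMap.coe_mk, AddHom.coe_mk, hv e he, if_false]
    split_ifs <;> norm_num
  · simp [coboundary, hv e₀ he₀]
  · intro S hST hS e he
    obtain ⟨j, hj⟩ := hS e he
    have h1 : p (t.x e) ≠ p (t.x e₀) := (hp _ _).2 ⟨j, rfl⟩ ▸ hv _ (hST hj)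
    simp [coboundary, hv e (hST he), h1]

variable [Finite E]

theorem exists_isClosed_persistent (hp : ∀ e e', p e = p e' ↔ ∃ j, t.Z^[j] e = e')
    {Φ : (E → ℝ) →ₗ[ℝ] ℝ} (hΦ : ∀ f, Φ (t.coboundary p f) = 0) {c : E → ℝ} (hc : t.IsClosed c)
    (hΦc : Φ c ≠ 0) :
    ∃ b, t.IsClosed b ∧ (∀ e, b e ≤ 1) ∧ {e | b e = 1}.Nonempty ∧ t.Persistent {e | b e = 1} := by
  have hpZ : ∀ e, p (t.Z e) = p e := fun e => ((hp _ _).2 ⟨1, rfl⟩).symm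
  have hzero : t.IsClosed 0 := fun e => by simp
  set B : Set (E → ℝ) := {b | t.IsClosed b ∧ ∀ e, b e ≤ 1}
  have hBcompact : IsCompact B := by
    refine (isCompact_univ_pi fun _ : E => isCompact_Icc (a := (-2 : ℝ)) (b := 1)).of_isClosed_subset
      ?_ ?_
    · have : B = (⋂ e, {b | b e + b (t.x e) + b (t.X e) = 0}) ∩
          (⋂ e, {b | b e + b (t.y e) + b (t.Y e) = 0}) ∩ ⋂ e, {b | b e ≤ 1} := by
        ext b
        simp only [B, TwoColoredTriangulation.IsClosed, Set.mem_ofPred_eq, Set.mem_inter_iff,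
          Set.mem_iInter, forall_and]
      rw [this]
      refine ((isClosed_iInter fun e => isClosed_eq ?_ ?_).inter
        (isClosed_iInter fun e => isClosed_eq ?_ ?_)).inter
        (isClosed_iInter fun e => isClosed_le ?_ ?_) <;> fun_prop
    · rintro b ⟨hb, hb1⟩ e -
      have := (hb e).1
      exact ⟨by linarith [hb1 (t.x e), hb1 (t.X e)], hb1 e⟩
  have hΦcont : Continuous Φ := Φ.continuous_of_finiteDimensional
  obtain ⟨b₀, hb₀, hmax⟩ := hBcompact.exists_isMaxOn
    ⟨0, hzero, fun _ => zero_le_one⟩ hΦcont.continuousOn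
  have hmax : ∀ b ∈ B, Φ b ≤ Φ b₀ := hmax
  have hpos : 0 < Φ b₀ := by
    obtain ⟨ε, hε, hle, -⟩ := exists_pos_add_smul_le_one (b := (0 : E → ℝ)) (η := Φ c • c)
      (by simp) (by simp)
    have hcc : t.IsClosed (Φ c • c) := by simpa using hzero.add_smul hc (Φ c)
    have h1 := hmax _ ⟨hzero.add_smul hcc ε, hle⟩
    simp only [zero_add, map_smul, smul_eq_mul] at h1
    have : 0 < ε * (Φ c * Φ c) := mul_pos hε (mul_self_pos.2 hΦc)
    linarith
  obtain ⟨b, ⟨⟨hb, hb1⟩, hbΦ⟩, hmin⟩ := (measure fun b : E → ℝ => {e | b e = 1}.ncard).wf.has_min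
    {b | b ∈ B ∧ Φ b = Φ b₀} ⟨b₀, hb₀, rfl⟩
  refine ⟨b, hb, hb1, ?_, ?_⟩
  · by_contra! hempty
    have hne : ∀ e, b e ≠ 1 := fun e he => Set.notMem_empty e (hempty ▸ he)
    obtain ⟨ε, hε, hle, -⟩ := exists_pos_add_smul_le_one (η := b) hb1
      fun e he => absurd he (hne e)
    have h1 := hmax _ ⟨hb.add_smul hb ε, hle⟩
    simp only [map_add, map_smul, smul_eq_mul, hbΦ] at h1
    nlinarith
  · by_contra hnot
    obtain ⟨f, hf1, ⟨e, he, hfe⟩, -⟩ := exists_coboundary_of_not_persistent hp hnot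
    obtain ⟨ε, hε, hle, hiff⟩ := exists_pos_add_smul_le_one (η := t.coboundary p f) hb1 hf1
    refine hmin _ ⟨⟨hb.add_smul (isClosed_coboundary hpZ f) ε, hle⟩, ?_⟩ ?_
    · simp [hΦ, hbΦ]
    · refine Set.ncard_lt_ncard (Set.ssubset_iff_exists.2 ⟨fun g hg => ((hiff g).1 hg).1, e, he, ?_⟩)
      exact fun h => hfe ((hiff e).1 h).2

theorem exists_isTight (hp : ∀ e e', p e = p e' ↔ ∃ j, t.Z^[j] e = e')
    {Φ : (E → ℝ) →ₗ[ℝ] ℝ} (hΦ : ∀ f, Φ (t.coboundary p f) = 0) {c : E → ℝ} (hc : t.IsClosed c)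
    (hΦc : Φ c ≠ 0) : ∃ b, t.IsTight b := by
  have hpZ : ∀ e, p (t.Z e) = p e := fun e => ((hp _ _).2 ⟨1, rfl⟩).symm
  obtain ⟨b₀, hb₀, hb₀1, hne, hper⟩ := exists_isClosed_persistent hp hΦ hc hΦc
  obtain ⟨b, ⟨hb, hb1, S₀, hS₀b, hS₀, hS₀p⟩, hmin⟩ :=
    (measure fun b : E → ℝ => {e | b e = 1}.ncard).wf.has_min
    {b | t.IsClosed b ∧ (∀ e, b e ≤ 1) ∧
      ∃ S ⊆ {e | b e = 1}, S.Nonempty ∧ t.Persistent S} ⟨b₀, hb₀, hb₀1, _, le_rfl, hne, hper⟩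
  have hminimal : ∀ η, t.IsClosed η → (∀ e, b e = 1 → η e ≤ 0) →
      ∀ S : Set E, S.Nonempty → t.Persistent S → (∀ e ∈ S, b e = 1 ∧ η e = 0) →
      ∀ e, b e = 1 → η e = 0 := by
    intro η hη hη0 S hS hSp hSη e he
    by_contra hηe
    obtain ⟨ε, hε, hle, hiff⟩ := exists_pos_add_smul_le_one hb1 hη0
    refine hmin _ ⟨hb.add_smul hη ε, hle, S, fun e he => (hiff e).2 (hSη e he), hS, hSp⟩ ?_
    refine Set.ncard_lt_ncard (Set.ssubset_iff_exists.2 ⟨fun g hg => ((hiff g).1 hg).1, e, he, ?_⟩)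
    exact fun h => hηe ((hiff e).1 h).2
  refine ⟨b, hb, hb1, hS₀.mono hS₀b, ?_, hminimal⟩
  by_contra hnot
  obtain ⟨f, hf1, ⟨e, he, hfe⟩, hf2⟩ := exists_coboundary_of_not_persistent hp hnot
  exact hfe (hminimal _ (isClosed_coboundary hpZ f) hf1 S₀ hS₀ hS₀p
    (fun e he => ⟨hS₀b he, hf2 S₀ hS₀b hS₀p e he⟩) e he)

end Existence

section Counting

variable [Fintype E] (t : TwoColoredTriangulation E)

/-- There are more edges than faces and vertices together, counted as for a torus. -/
theorem false_of_card {A B C : Type*} [Fintype A] [Fintype B] [Fintype C] {N : ℕ}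
    (hE : Fintype.card E = 3 * N) (hA : Fintype.card A ≤ N) (hB : Fintype.card B ≤ N)
    (hC : Fintype.card C ≤ N) {r : A → E} {s : B → E} {p : E → C}
    (hr : ∀ e, ∃ a, e = r a ∨ e = t.x (r a) ∨ e = t.X (r a))
    (hs : ∀ e, ∃ a, e = s a ∨ e = t.y (s a) ∨ e = t.Y (s a))
    (hp : ∀ e e', p e = p e' ↔ ∃ j, t.Z^[j] e = e') : False := by
  let L : (E → ℝ) →ₗ[ℝ] (A → ℝ) × (B → ℝ) := LinearMap.prod
    (LinearMap.pi fun a => (LinearMap.proj (r a) : (E → ℝ) →ₗ[ℝ] ℝ) + LinearMap.proj (t.x (r a)) +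
      LinearMap.proj (t.X (r a)))
    (LinearMap.pi fun a => (LinearMap.proj (s a) : (E → ℝ) →ₗ[ℝ] ℝ) + LinearMap.proj (t.y (s a)) +
      LinearMap.proj (t.Y (s a)))
  have hker : ∀ b ∈ LinearMap.ker L, t.IsClosed b := by
    intro b hb
    rw [LinearMap.mem_ker, Prod.ext_iff] at hb
    obtain ⟨h1, h2⟩ := hb
    intro e
    constructor
    · obtain ⟨a, ha⟩ := hr e
      have h3 : b (r a) + b (t.x (r a)) + b (t.X (r a)) = 0 := congrFun h1 a
      rcases ha with rfl | rfl | rfl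
      · exact h3
      · rw [t.xx, t.Xx]; linarith
      · rw [t.xX, t.XX]; linarith
    · obtain ⟨a, ha⟩ := hs e
      have h3 : b (s a) + b (t.y (s a)) + b (t.Y (s a)) = 0 := congrFun h2 a
      rcases ha with rfl | rfl | rfl
      · exact h3
      · rw [t.yy, t.Yy]; linarith
      · rw [t.yY, t.YY]; linarith
  have hL := LinearMap.finrank_range_add_finrank_ker L
  have hL' := Submodule.finrank_le (LinearMap.range L)
  have hD := LinearMap.finrank_range_add_finrank_ker (t.coboundary p)
  simp only [Module.finrank_prod, Module.finrank_fintype_fun_eq_card] at hL hL' hD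
  have hD' : 0 < Module.finrank ℝ (LinearMap.ker (t.coboundary p)) := by
    refine Module.finrank_pos_iff_exists_ne_zero.2 ⟨⟨fun _ => 1, ?_⟩, fun h => ?_⟩
    · ext e; simp [coboundary]
    · simpa using congrFun (congrArg Subtype.val h) (p (t.o 0))
  obtain ⟨c, hc, hcD⟩ := SetLike.not_le_iff_exists.1 fun hle :
      LinearMap.ker L ≤ LinearMap.range (t.coboundary p) => by
    have := Submodule.finrank_mono hle
    omega
  obtain ⟨Φ, hΦc, hΦ⟩ := Submodule.exists_dual_map_eq_bot_of_notMem hcD inferInstance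
  obtain ⟨b, hb⟩ := exists_isTight hp (Φ := Φ) (fun f => by
    have : Φ (t.coboundary p f) ∈ (LinearMap.range (t.coboundary p)).map Φ :=
      Submodule.mem_map_of_mem ⟨f, rfl⟩
    rwa [hΦ, Submodule.mem_bot] at this) (hker c hc) hΦc
  exact hb.false

end Counting

end TwoColoredTriangulation

section CycleType

open Equiv Equiv.Perm

variable {α : Type*} [Fintype α] [DecidableEq α] {σ : Perm α}

theorem cycleType_eq_of_fullCycleType_eq {M : Multiset ℕ} (h : fullCycleType σ = M)
    (h1 : 1 ∉ M) : σ.cycleType = M ∧ ∀ e, σ e ≠ e := by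
  have h0 : Fintype.card α - σ.cycleType.sum = 0 := by
    by_contra h0
    apply h1
    rw [← h, fullCycleType]
    exact Multiset.mem_add.2 (Or.inr (Multiset.mem_replicate.2 ⟨h0, rfl⟩))
  refine ⟨by rw [← h, fullCycleType, h0]; simp, fun e => ?_⟩
  have hle := σ.sum_cycleType_le
  rw [← mem_support, Finset.eq_univ_of_card σ.support (by rw [← sum_cycleType]; lia)]
  exact Finset.mem_univ e

theorem card_quotient_sameCycle_le (hσ : ∀ e, σ e ≠ e) :
    Nat.card (Quotient (SameCycle.setoid σ)) ≤ Multiset.card σ.cycleType := by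
  have hs : ∀ e, e ∈ σ.support := fun e => mem_support.2 (hσ e)
  let f : Quotient (SameCycle.setoid σ) → σ.cycleFactorsFinset :=
    Quotient.lift (fun e => ⟨σ.cycleOf e, cycleOf_mem_cycleFactorsFinset_iff.2 (hs e)⟩)
      fun a b hab => Subtype.ext ((sameCycle_iff_cycleOf_eq_of_mem_support (hs a) (hs b)).1 hab)
  have hf : Function.Injective f := by
    rintro ⟨a⟩ ⟨b⟩ hab
    exact Quotient.sound
      ((sameCycle_iff_cycleOf_eq_of_mem_support (hs a) (hs b)).2 (Subtype.ext_iff.1 hab))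
  calc _ ≤ Nat.card σ.cycleFactorsFinset := Nat.card_le_card_of_injective f hf
    _ = _ := by simp [cycleType_def]

theorem card_support_cycleOf_mem_cycleType {e : α} (he : σ e ≠ e) :
    (σ.cycleOf e).support.card ∈ σ.cycleType := by
  rw [cycleType_def]
  exact Multiset.mem_map_of_mem (Finset.card ∘ support)
    (cycleOf_mem_cycleFactorsFinset_iff.2 (mem_support.2 he))

theorem cycleOf_eq_of_count_cycleType {a b : α} (ha : σ a ≠ a) (hb : σ b ≠ b)
    (hab : (σ.cycleOf a).support.card = (σ.cycleOf b).support.card)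
    (h1 : σ.cycleType.count (σ.cycleOf a).support.card = 1) : σ.cycleOf a = σ.cycleOf b := by
  rw [cycleType_def, Multiset.count_map, Multiset.card_eq_one] at h1
  obtain ⟨c, hc⟩ := h1
  have key : ∀ e, σ e ≠ e → (σ.cycleOf a).support.card = (σ.cycleOf e).support.card →
      σ.cycleOf e = c := fun e he h => by
    rw [← Multiset.mem_singleton, ← hc, Multiset.mem_filter]
    exact ⟨cycleOf_mem_cycleFactorsFinset_iff.2 (mem_support.2 he), h⟩
  rw [key a ha rfl, key b hb hab]

theorem exists_unique_four_cycle {m : ℕ}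
    (hc : σ.cycleType = 2 ::ₘ 4 ::ₘ Multiset.replicate m 3) (hσ : ∀ e, σ e ≠ e) :
    ∃ o : ZMod 4 → α, Function.Injective o ∧ (∀ k, σ (o k) = o (k + 1)) ∧
      ∀ e, (∀ k, e ≠ o k) → (σ (σ e) = e ∧ σ e ≠ e) ∨ σ (σ (σ e)) = e := by
  have hmem : ∀ e, e ∈ (σ.cycleOf e).support := fun e =>
    (mem_support_cycleOf_iff' (hσ e)).2 (SameCycle.refl σ e)
  have hpow : ∀ e, (σ ^ (σ.cycleOf e).support.card) e = e := fun e =>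
    (σ.isCycleOn_support_cycleOf e).pow_card_apply (hmem e)
  obtain ⟨e₀, he₀⟩ : ∃ e, (σ.cycleOf e).support.card = 4 := by
    have h4 : 4 ∈ σ.cycleType := by simp [hc]
    rw [cycleType_def, Multiset.mem_map] at h4
    obtain ⟨c, hcm, hc4⟩ := h4
    have hcm' : c ∈ σ.cycleFactorsFinset := hcm
    obtain ⟨e, he⟩ := (mem_cycleFactorsFinset_iff.1 hcm').1.nonempty_support
    refine ⟨e, ?_⟩
    rw [← cycle_is_cycleOf he hcm']
    exact hc4
  have hmod : ∀ i j : ℕ, (σ ^ i) e₀ = (σ ^ j) e₀ ↔ i ≡ j [MOD 4] := fun i j => by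
    rw [(σ.isCycleOn_support_cycleOf e₀).pow_apply_eq_pow_apply (hmem e₀), he₀]
  refine ⟨fun k => (σ ^ k.val) e₀, fun i j hij => ?_, fun k => ?_, fun e he => ?_⟩
  · have := (hmod _ _).1 hij
    rwa [← ZMod.natCast_eq_natCast_iff, ZMod.natCast_zmod_val, ZMod.natCast_zmod_val] at this
  · rw [← Perm.mul_apply, ← pow_succ', hmod, ← ZMod.natCast_eq_natCast_iff]
    simp
  · have hm := card_support_cycleOf_mem_cycleType (hσ e)
    have hp := hpow e
    rw [hc, Multiset.mem_cons, Multiset.mem_cons, Multiset.mem_replicate] at hm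
    rcases hm with h | h | ⟨-, h⟩
    · rw [h] at hp
      exact Or.inl ⟨hp, hσ e⟩
    · exfalso
      have hcc : σ.cycleOf e₀ = σ.cycleOf e := by
        apply cycleOf_eq_of_count_cycleType (hσ _) (hσ _) (he₀.trans h.symm)
        rw [he₀, hc]
        simp [Multiset.count_replicate]
      have hs := (sameCycle_iff_cycleOf_eq_of_mem_support
        (mem_support.2 (hσ _)) (mem_support.2 (hσ _))).2 hcc
      obtain ⟨i, hi⟩ := hs.exists_nat_pow_eq
      apply he (i : ZMod 4)
      rw [← hi]
      dsimp only
      rw [hmod, ← ZMod.natCast_eq_natCast_iff, ZMod.natCast_zmod_val]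
    · rw [h] at hp
      exact Or.inr hp

theorem pow_three_eq_one_of_cycleType {m : ℕ} (hc : σ.cycleType = Multiset.replicate m 3) :
    σ ^ 3 = 1 := by
  rw [← orderOf_dvd_iff_pow_eq_one, ← lcm_cycleType, Multiset.lcm_dvd, hc]
  intro b hb
  rw [Multiset.eq_of_mem_replicate hb]

end CycleType

section Orbits

open Equiv Equiv.Perm

variable {α : Type*} {σ : Perm α}

theorem exists_quotient_out_of_pow_three [Finite α] (h3 : σ ^ 3 = 1) (e : α) :
    ∃ q : Quotient (SameCycle.setoid σ), e = q.out ∨ e = σ q.out ∨ e = σ⁻¹ q.out := by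
  refine ⟨Quotient.mk _ e, ?_⟩
  have hs : σ.SameCycle (Quotient.mk (SameCycle.setoid σ) e).out e :=
    @Quotient.mk_out α (SameCycle.setoid σ) e
  obtain ⟨i, hi, h⟩ := hs.exists_pow_eq'
  have ho : i < 3 := hi.trans_le (orderOf_le_of_pow_eq_one (by norm_num) h3)
  have h2 : σ⁻¹ = σ ^ 2 := inv_eq_of_mul_eq_one_left (by rw [← pow_succ, h3])
  rw [h2]
  interval_cases i
  · exact Or.inl h.symm
  · exact Or.inr (Or.inl h.symm)
  · exact Or.inr (Or.inr h.symm)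

theorem mem_of_isTransitiveSet {s : Set (Perm α)} (hs : IsTransitiveSet s) {S : Set α}
    (hS : S.Nonempty) (h : ∀ g ∈ s, ∀ e, g e ∈ S ↔ e ∈ S) (e : α) : e ∈ S := by
  obtain ⟨a, ha⟩ := hS
  obtain ⟨g, hg, rfl⟩ := hs a e
  suffices H : ∀ e, g e ∈ S ↔ e ∈ S from (H a).2 ha
  induction hg using Subgroup.closure_induction with
  | mem g hg => exact h g hg
  | one => simp
  | mul g k _ _ hg hk => intro e; rw [Perm.mul_apply, hg, hk]
  | inv g _ hg => intro e; rw [← hg]; exact iff_of_eq (congrArg (· ∈ S) (g.apply_symm_apply e))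

theorem apply_mem_iff_of_pow_three (h3 : σ ^ 3 = 1) {S : Set α}
    (h : ∀ e ∈ S, σ e ∈ S) (e : α) : σ e ∈ S ↔ e ∈ S :=
  ⟨fun he => by
    have := h _ (h _ he)
    rwa [show σ (σ (σ e)) = (σ ^ 3) e from rfl, h3] at this, h e⟩

end Orbits

/-- The genus-1 ramification type (B): [2,4,3^*][3^*][3^*] is not realizable in any degree. -/
theorem stmt7 (n : ℕ) (hn : 6 ≤ n) (h3 : 3 ∣ n) :
    ¬ Realizable n
      [2 ::ₘ 4 ::ₘ Multiset.replicate ((n - 6) / 3) 3,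
        Multiset.replicate (n / 3) 3,
        Multiset.replicate (n / 3) 3] := by
  rintro ⟨σ, hσ, hprod, htrans⟩
  match σ with
  | [] => simp at hσ
  | [_] => simp at hσ
  | [_, _] => simp at hσ
  | _ :: _ :: _ :: _ :: _ => simp at hσ
  | [z, x, y] =>
  simp only [List.map_cons, List.map_nil, List.cons.injEq, and_true] at hσ
  simp only [List.prod_cons, List.prod_nil, mul_one] at hprod
  obtain ⟨hz, hx, hy⟩ := hσ
  obtain ⟨hz, hz1⟩ := cycleType_eq_of_fullCycleType_eq hz (by simp [Multiset.mem_replicate])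
  obtain ⟨hx, hx1⟩ := cycleType_eq_of_fullCycleType_eq hx (by simp [Multiset.mem_replicate])
  obtain ⟨hy, hy1⟩ := cycleType_eq_of_fullCycleType_eq hy (by simp [Multiset.mem_replicate])
  have hx3 := pow_three_eq_one_of_cycleType hx
  have hy3 := pow_three_eq_one_of_cycleType hy
  have hzxy : z = y⁻¹ * x⁻¹ := by rw [eq_inv_of_mul_eq_one_left hprod, mul_inv_rev]
  have hz' : ∀ e, y⁻¹ (x⁻¹ e) = z e := fun e => by rw [hzxy]; rfl
  obtain ⟨o, ho, hzo, hother⟩ := exists_unique_four_cycle hz hz1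
  have hx2 : ∀ e, x (x e) = x⁻¹ e := fun e => by
    rw [inv_eq_of_mul_eq_one_left (show x ^ 2 * x = 1 by rw [← pow_succ, hx3])]; rfl
  have hy2 : ∀ e, y⁻¹ (y⁻¹ e) = y e := fun e => by
    rw [Equiv.Perm.inv_eq_iff_eq, Equiv.Perm.inv_eq_iff_eq]
    exact (congrArg (· e) hy3).symm
  let t : TwoColoredTriangulation (Fin n) :=
    { x := ⇑x, X := ⇑x⁻¹, y := ⇑y⁻¹, Y := ⇑y
      xx := hx2
      xX := fun e => x.apply_symm_apply e
      yy := hy2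
      yY := fun e => y.symm_apply_apply e
      o := o
      o_injective := ho
      yX_o := fun k => by rw [hz', hzo]
      other := fun e he => by simpa only [hz'] using hother e he
      connected := fun S hS hSx hSy => by
        have hxS := apply_mem_iff_of_pow_three hx3 hSx
        have hyS := apply_mem_iff_of_pow_three (σ := y⁻¹) (by rw [inv_pow, hy3, inv_one]) hSy
        refine mem_of_isTransitiveSet htrans hS fun g hg e => ?_
        simp only [List.mem_cons, List.not_mem_nil, or_false, Set.mem_ofPred_eq] at hg
        rcases hg with rfl | rfl | rfl
        · rw [← hz', hyS, ← hxS]; exact iff_of_eq (congrArg (· ∈ S) (Equiv.apply_symm_apply _ e))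
        · exact hxS e
        · rw [← hyS]; exact iff_of_eq (congrArg (· ∈ S) (Equiv.symm_apply_apply _ e)) }
  have htZ : t.Z = ⇑z⁻¹ := by
    ext e
    rw [hzxy, mul_inv_rev, inv_inv, inv_inv]
    rfl
  have hcard : ∀ σ : Equiv.Perm (Fin n), Multiset.card σ.cycleType = n / 3 → (∀ e, σ e ≠ e) →
      ∀ [Fintype (Quotient (Equiv.Perm.SameCycle.setoid σ))],
        Fintype.card (Quotient (Equiv.Perm.SameCycle.setoid σ)) ≤ n / 3 := fun σ hσ hσ1 _ => by
    rw [← hσ, ← Nat.card_eq_fintype_card]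
    exact card_quotient_sameCycle_le hσ1
  classical
  let _ := Fintype.ofFinite (Quotient (Equiv.Perm.SameCycle.setoid x))
  let _ := Fintype.ofFinite (Quotient (Equiv.Perm.SameCycle.setoid y⁻¹))
  let _ := Fintype.ofFinite (Quotient (Equiv.Perm.SameCycle.setoid z))
  refine t.false_of_card (N := n / 3) (r := Quotient.out) (s := Quotient.out)
    (p := Quotient.mk (Equiv.Perm.SameCycle.setoid z))
    (by rw [Fintype.card_fin]; lia) (hcard x (by simp [hx]) hx1)
    (hcard y⁻¹ (by simp [hy]) fun e he => hy1 e ?_) (hcard z (by simp [hz]; lia) hz1)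
    (exists_quotient_out_of_pow_three hx3) (fun e => ?_) fun a b => ?_
  · rw [Equiv.Perm.inv_eq_iff_eq] at he
    exact he.symm
  · exact exists_quotient_out_of_pow_three (σ := y⁻¹) (by rw [inv_pow, hy3, inv_one]) e
  · rw [Quotient.eq, htZ]
    constructor
    · intro h
      obtain ⟨j, hj⟩ := (Equiv.Perm.sameCycle_inv.2 h).exists_nat_pow_eq
      exact ⟨j, by rw [Equiv.Perm.iterate_eq_pow, hj]⟩
    · rintro ⟨j, hj⟩
      rw [Equiv.Perm.iterate_eq_pow] at hj
      exact Equiv.Perm.sameCycle_inv.1 ⟨j, by exact_mod_cast hj⟩
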